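/- arXiv:0903.4355 — 2 statements merged into one kernel-verified Lean document; each statement's English description precedes it below -/
import Mathlib

section
/- For every positive integer c there exists N such that every metric on N ordered points which is monochromatic of colour 132 — i.e. every quadruple of indices a < b < c < d satisfies R₁ > R₃ > R₂, where R₁ = d(a,b) + d(c,d), R₂ = d(a,c) + d(b,d), R₃ = d(a,d) + d(b,c) — admits an isometric embedding into l_∞^{N−c}. -/
/-- `l_∞^k`: `ℝ^k` with the supremum distance. -/
abbrev LinfSpace (k : ℕ) := PiLp ⊤ (fun _ : Fin k => ℝ)

/-- A metric on `Fin n`, given as an explicit distance function. -/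
def IsMetric {n : ℕ} (d : Fin n → Fin n → ℝ) : Prop :=
  (∀ i, d i i = 0) ∧ (∀ i j, d i j = d j i) ∧ (∀ i j, i ≠ j → 0 < d i j) ∧
  (∀ i j k, d i k ≤ d i j + d j k)

/-! We take `N = 3 * c` (so that the target is the genuine space `l_∞^{2c}`).  The points come in
`c` blocks `3k, 3k+1, 3k+2`; the block `k` contributes two coordinates, both of the shape `coordFn`:
one centred at `3k+2` and modified on the points `3j+1`, `j > k`, and one centred at `3k` and
modified on the points `3i+2`, `i < k`. -/

/-- The coordinate function: `-d(s,·)` off `Y`, and `d(t,·) - d(s,t)` on `Y`. -/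
noncomputable def coordFn {n : ℕ} (d : Fin n → Fin n → ℝ) (s t : Fin n) (Y : Fin n → Prop)
    (z : Fin n) : ℝ :=
  open Classical in if Y z then d t z - d s t else - d s z

theorem coordFn_lip {n : ℕ} (d : Fin n → Fin n → ℝ) (hd : IsMetric d) (s t : Fin n)
    (Y : Fin n → Prop)
    (h : ∀ y z, Y y → ¬ Y z → z ≠ s → z ≠ t → d t y + d s z ≤ d s t + d y z) (u v : Fin n) :
    |coordFn d s t Y u - coordFn d s t Y v| ≤ d u v := by
  obtain ⟨h0, hs, -, ht⟩ := hd
  have h' : ∀ y z, Y y → ¬ Y z → d t y + d s z ≤ d s t + d y z := by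
    intro y z hy hz
    by_cases h1 : z = s
    · subst h1
      linarith [ht t z y, h0 z, hs t z, hs y z]
    by_cases h2 : z = t
    · subst h2
      linarith [hs y z]
    exact h y z hy hz h1 h2
  rw [abs_le]
  unfold coordFn
  split_ifs with h1 h2 h2
  · constructor <;> linarith [ht t u v, ht t v u, hs u v]
  · constructor
    · linarith [ht s v t, ht v u t, hs u v, hs u t]
    · linarith [h' u v h1 h2]
  · constructor
    · linarith [h' v u h2 h1, hs u v]
    · linarith [ht s u t, ht u v t, hs u v, hs v t]
  · constructor <;> linarith [ht s u v, ht s v u, hs u v]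

theorem coordFn_tight_s {n : ℕ} (d : Fin n → Fin n → ℝ) (hd : IsMetric d) (s t : Fin n)
    (Y : Fin n → Prop) (z : Fin n) (hs : ¬ Y s) (hz : ¬ Y z) :
    d s z ≤ |coordFn d s t Y s - coordFn d s t Y z| := by
  refine le_trans ?_ (le_abs_self _)
  simp only [coordFn, if_neg hs, if_neg hz, hd.1 s]
  linarith

theorem coordFn_tight_t {n : ℕ} (d : Fin n → Fin n → ℝ) (s t : Fin n)
    (Y : Fin n → Prop) (z : Fin n) (ht : ¬ Y t) (hz : Y z) :
    d t z ≤ |coordFn d s t Y t - coordFn d s t Y z| := by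
  rw [abs_sub_comm]
  refine le_trans ?_ (le_abs_self _)
  simp only [coordFn, if_neg ht, if_pos hz]
  linarith

theorem embeds_of_family {n m : ℕ} (d : Fin n → Fin n → ℝ) (hd : IsMetric d)
    (F : Fin m → Fin n → ℝ) (hF : ∀ k u v, |F k u - F k v| ≤ d u v)
    (hc : ∀ u v, u < v → ∃ k, d u v ≤ |F k u - F k v|) :
    ∃ f : Fin n → LinfSpace m, ∀ x y : Fin n, dist (f x) (f y) = d x y := by
  have hnn : ∀ u v, 0 ≤ d u v := by
    intro u v
    linarith [hd.2.2.2 u v u, hd.1 u, hd.2.1 u v]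
  refine ⟨fun x => WithLp.toLp ⊤ (fun k => F k x), fun x y => ?_⟩
  have key : dist (WithLp.toLp ⊤ (fun k => F k x) : LinfSpace m)
      (WithLp.toLp ⊤ (fun k => F k y)) = dist (fun k => F k x) (fun k => F k y) :=
    (PiLp.isometry_ofLp_infty (fun _ : Fin m => ℝ)).dist_eq _ _ |>.symm
  rw [key]
  apply le_antisymm
  · rw [dist_pi_le_iff (hnn x y)]
    intro k
    rw [Real.dist_eq]
    exact hF k x y
  · have aux : ∀ k, |F k x - F k y| ≤ dist (fun k => F k x) (fun k => F k y) := fun k =>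
      dist_le_pi_dist (fun k => F k x) (fun k => F k y) k
    rcases lt_trichotomy x y with h | h | h
    · obtain ⟨k, hk⟩ := hc x y h
      exact hk.trans (aux k)
    · subst h
      rw [hd.1]
      exact dist_nonneg
    · obtain ⟨k, hk⟩ := hc y x h
      rw [abs_sub_comm, hd.2.1] at hk
      exact hk.trans (aux k)

/-- The substantive form, with `N = 3 * c`. -/
theorem embeds_three_mul (c : ℕ) (d : Fin (3 * c) → Fin (3 * c) → ℝ) (hd : IsMetric d)
    (hm : ∀ a b c' e : Fin (3 * c), a < b → b < c' → c' < e →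
        d a b + d c' e > d a e + d b c' ∧ d a e + d b c' > d a c' + d b e) :
    ∃ f : Fin (3 * c) → LinfSpace (3 * c - c), ∀ x y, dist (f x) (f y) = d x y := by
  have hs := hd.2.1
  let P : Fin c → Fin (3 * c) := fun k => ⟨3 * k, by omega⟩
  let T : Fin c → Fin (3 * c) := fun k => ⟨3 * k + 1, by omega⟩
  let S : Fin c → Fin (3 * c) := fun k => ⟨3 * k + 2, by omega⟩
  let Y : Fin c → Fin (3 * c) → Prop := fun k z => z.val % 3 = 1 ∧ 3 * k.val + 2 < z.val
  let X : Fin c → Fin (3 * c) → Prop := fun k z => z.val % 3 = 2 ∧ z.val < 3 * k.val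
  let F : Fin (3 * c - c) → Fin (3 * c) → ℝ := fun e =>
    if h : e.val < c then coordFn d (S ⟨e, h⟩) (T ⟨e, h⟩) (Y ⟨e, h⟩)
    else coordFn d (P ⟨e - c, by omega⟩) (T ⟨e - c, by omega⟩) (X ⟨e - c, by omega⟩)
  have F1 : ∀ k : Fin c, ∃ e, F e = coordFn d (S k) (T k) (Y k) := by
    intro k
    refine ⟨⟨k.val, by omega⟩, ?_⟩
    simp [F]
  have F2 : ∀ k : Fin c, ∃ e, F e = coordFn d (P k) (T k) (X k) := by
    intro k
    refine ⟨⟨c + k.val, by omega⟩, ?_⟩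
    simp [F]
  apply embeds_of_family d hd F
  · intro e u v
    by_cases he : e.val < c
    · simp only [F, dif_pos he]
      apply coordFn_lip d hd
      intro y z hy hz hzs hzt
      generalize (⟨e.val, he⟩ : Fin c) = k at *
      have hts : T k < S k := by simp [T, S]
      have hsy : S k < y := Fin.lt_def.2 hy.2
      have hzy : z ≠ y := fun h => hz (h ▸ hy)
      rcases lt_or_gt_of_ne hzt with h1 | h1
      · linarith [hm z (T k) (S k) y h1 hts hsy, hs (S k) (T k), hs (S k) z, hs y z]
      have h2 : S k < z := by
        have : z.val ≠ (S k).val := fun h => hzs (Fin.ext h)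
        simp only [Fin.lt_def, S, T] at *
        omega
      rcases lt_or_gt_of_ne hzy with h3 | h3
      · linarith [hm (T k) (S k) z y hts h2 h3, hs (S k) (T k), hs y z]
      · linarith [hm (T k) (S k) y z hts hsy h3, hs (S k) (T k)]
    · simp only [F, dif_neg he]
      apply coordFn_lip d hd
      intro y z hy hz hzs hzt
      generalize (⟨e.val - c, by omega⟩ : Fin c) = k at *
      have hst : P k < T k := by simp [T, P]
      have hys : y < P k := Fin.lt_def.2 hy.2
      have hzy : z ≠ y := fun h => hz (h ▸ hy)
      rcases lt_or_gt_of_ne hzt.symm with h1 | h1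
      · linarith [hm y (P k) (T k) z hys hst h1, hs (T k) y]
      have h2 : z < P k := by
        have : z.val ≠ (P k).val := fun h => hzs (Fin.ext h)
        simp only [Fin.lt_def, P, T] at *
        omega
      rcases lt_or_gt_of_ne hzy with h3 | h3
      · linarith [hm z y (P k) (T k) h3 hys hst, hs (T k) y, hs (P k) z, hs y z]
      · linarith [hm y z (P k) (T k) h3 h2 hst, hs (T k) y, hs (P k) z]
  · -- every pair is tight for some coordinate
    have cS : ∀ (k : Fin c) z, ¬ Y k z → ∃ e, d (S k) z ≤ |F e (S k) - F e z| := by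
      intro k z hz
      obtain ⟨e, he⟩ := F1 k
      refine ⟨e, ?_⟩
      rw [he]
      exact coordFn_tight_s d hd _ _ _ _ (by simp [Y, S]) hz
    have cP : ∀ (k : Fin c) z, ¬ X k z → ∃ e, d (P k) z ≤ |F e (P k) - F e z| := by
      intro k z hz
      obtain ⟨e, he⟩ := F2 k
      refine ⟨e, ?_⟩
      rw [he]
      exact coordFn_tight_s d hd _ _ _ _ (by simp [X, P]) hz
    have cY : ∀ (k : Fin c) z, Y k z → ∃ e, d (T k) z ≤ |F e (T k) - F e z| := by
      intro k z hz
      obtain ⟨e, he⟩ := F1 k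
      refine ⟨e, ?_⟩
      rw [he]
      exact coordFn_tight_t d _ _ _ _ (by simp [Y, T]) hz
    have cX : ∀ (k : Fin c) z, X k z → ∃ e, d (T k) z ≤ |F e (T k) - F e z| := by
      intro k z hz
      obtain ⟨e, he⟩ := F2 k
      refine ⟨e, ?_⟩
      rw [he]
      exact coordFn_tight_t d _ _ _ _ (by simp [X, T]) hz
    have sym : ∀ u v, (∃ e, d v u ≤ |F e v - F e u|) → ∃ e, d u v ≤ |F e u - F e v| := by
      rintro u v ⟨e, he⟩
      exact ⟨e, by rwa [abs_sub_comm, hs]⟩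
    have cases3 : ∀ z : Fin (3 * c), ∃ k, z = P k ∨ z = T k ∨ z = S k := by
      intro z
      refine ⟨⟨z.val / 3, by omega⟩, ?_⟩
      simp only [Fin.ext_iff, P, T, S]
      omega
    intro u v huv
    obtain ⟨i, hi⟩ := cases3 u
    obtain ⟨j, hj⟩ := cases3 v
    rcases hi with rfl | rfl | rfl <;> rcases hj with rfl | rfl | rfl <;>
      simp only [P, T, S, Fin.lt_def] at huv
    · exact cP i _ (by simp only [X, P]; omega)
    · exact cP i _ (by simp only [X, T]; omega)
    · exact cP i _ (by simp only [X, S]; omega)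
    · exact sym _ _ (cP j _ (by simp only [X, T]; omega))
    · exact cY i _ (by simp only [Y, T]; omega)
    · exact sym _ _ (cS j _ (by simp only [Y, T]; omega))
    · exact cS i _ (by simp only [Y, P]; omega)
    · exact sym _ _ (cX j _ (by simp only [X, S]; omega))
    · exact cS i _ (by simp only [Y, S]; omega)

/-- For every positive integer `c` there exists `N` such that every metric on `N`
ordered points which is monochromatic of colour 132 — every quadruple
`a < b < c < e` satisfies `R₁ > R₃ > R₂`, where `R₁ = d a b + d c e`,
`R₂ = d a c + d b e`, `R₃ = d a e + d b c` — embeds isometrically into `l_∞^{N-c}`. -/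
theorem monochromatic_132_embeds (c : ℕ) (hc : 0 < c) :
    ∃ N : ℕ, ∀ d : Fin N → Fin N → ℝ, IsMetric d →
      (∀ a b c' e : Fin N, a < b → b < c' → c' < e →
        d a b + d c' e > d a e + d b c' ∧ d a e + d b c' > d a c' + d b e) →
      ∃ f : Fin N → LinfSpace (N - c), ∀ x y : Fin N, dist (f x) (f y) = d x y :=
  ⟨3 * c, fun d hd hm => embeds_three_mul c d hd hm⟩
end

section
/- For every positive integer k there exists N such that the following holds: for every metric d on N ordered points whose pairwise distances (d(i,j) for i < j) are linearly independent over ℚ, there exist a strictly increasing map g : Fin k → Fin N and a permutation σ of {1,2,3} such that for all indices a < b < c < e in the image of g one has R_{σ(1)} > R_{σ(2)} > R_{σ(3)}, where R₁ = d(a,b) + d(c,e), R₂ = d(a,c) + d(b,e), R₃ = d(a,e) + d(b,c). That is, every generic metric space on sufficiently many ordered points contains a monochromatic subspace of k points. -/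
/-- The three sums `R₁ = d a b + d c e`, `R₂ = d a c + d b e`, `R₃ = d a e + d b c`
associated to a quadruple `a < b < c < e`, as a vector indexed by `Fin 3`. -/
def Rvec {n : ℕ} (d : Fin n → Fin n → ℝ) (a b c e : Fin n) : Fin 3 → ℝ :=
  ![d a b + d c e, d a c + d b e, d a e + d b c]

theorem ramsey_aux (C : Type) [Fintype C] [Nonempty C] (r : ℕ) :
    ∀ m : ℕ, ∃ N : ℕ, ∀ (α : Type) [LinearOrder α] (S : Finset α), N ≤ S.card →
      ∀ f : Finset α → C, ∃ T ⊆ S, T.card = m ∧ ∃ c, ∀ A ⊆ T, A.card = r → f A = c := by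
  classical
  induction r with
  | zero =>
    intro m
    refine ⟨m, fun α _ S hS f => ?_⟩
    obtain ⟨T, hT, hc⟩ := Finset.exists_subset_card_eq hS
    refine ⟨T, hT, hc, f ∅, fun A _ hA => ?_⟩
    rw [Finset.card_eq_zero.1 hA]
  | succ r ih =>
    have key : ∀ M : ℕ, ∃ N : ℕ, ∀ (α : Type) [LinearOrder α] (S : Finset α), N ≤ S.card →
        ∀ f : Finset α → C, ∃ T ⊆ S, T.card = M ∧ ∃ φ : α → C, ∀ x ∈ T, ∀ A ⊆ T,
          A.card = r → (∀ y ∈ A, x < y) → f (insert x A) = φ x := by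
      intro M
      induction M with
      | zero =>
        refine ⟨0, fun α _ S _ f => ⟨∅, by simp, by simp, fun _ => Classical.arbitrary C, ?_⟩⟩
        simp
      | succ M ihM =>
        obtain ⟨N1, h1⟩ := ihM
        obtain ⟨N2, h2⟩ := ih N1
        refine ⟨N2 + 1, fun α _ S hS f => ?_⟩
        have hne : S.Nonempty := Finset.card_pos.1 (by omega)
        set x := S.min' hne with hx
        have hxS : x ∈ S := Finset.min'_mem _ _
        have hcard : N2 ≤ (S.erase x).card := by
          rw [Finset.card_erase_of_mem hxS]; omega
        obtain ⟨T1, hT1, hc1, c, hc⟩ := h2 α (S.erase x) hcard (fun A => f (insert x A))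
        obtain ⟨T2, hT2, hc2, φ, hφ⟩ := h1 α T1 hc1.ge f
        have hlt : ∀ y ∈ T2, x < y := fun y hy =>
          Finset.min'_lt_of_mem_erase_min' _ _ (hT1 (hT2 hy))
        have hxT : x ∉ T2 := fun h => lt_irrefl _ (hlt x h)
        refine ⟨insert x T2, ?_, ?_, Function.update φ x c, ?_⟩
        · intro y hy
          rcases Finset.mem_insert.1 hy with rfl | hy
          · exact hxS
          · exact Finset.mem_of_mem_erase (hT1 (hT2 hy))
        · rw [Finset.card_insert_of_notMem hxT, hc2]
        · intro y hy A hA hAr hyA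
          have hyx : x ≤ y := by
            rcases Finset.mem_insert.1 hy with h | h
            · exact h.ge
            · exact (hlt y h).le
          have hA2 : A ⊆ T2 := by
            intro z hz
            rcases Finset.mem_insert.1 (hA hz) with h | h
            · exact absurd (hyA z hz) (by rw [h]; exact not_lt.2 hyx)
            · exact h
          rcases Finset.mem_insert.1 hy with h | h
          · rw [h, Function.update_self]
            exact hc A (hA2.trans hT2) hAr
          · rw [Function.update_of_ne (hlt y h).ne']
            exact hφ y h A hA2 hAr hyA
    intro m
    obtain ⟨N, hN⟩ := key (Fintype.card C * m)
    refine ⟨N, fun α _ S hS f => ?_⟩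
    obtain ⟨T, hT, hTc, φ, hφ⟩ := hN α S hS f
    obtain ⟨c, -, hc⟩ := Finset.exists_le_card_fiber_of_mul_le_card_of_maps_to
      (s := T) (t := (Finset.univ : Finset C)) (f := φ) (n := m) (fun _ _ => Finset.mem_univ _)
      Finset.univ_nonempty (by rw [hTc, Finset.card_univ])
    obtain ⟨U, hU, hUc⟩ := Finset.exists_subset_card_eq hc
    have hUT : U ⊆ T := hU.trans (Finset.filter_subset _ _)
    refine ⟨U, hUT.trans hT, hUc, c, fun A hA hAr => ?_⟩
    have hne : A.Nonempty := Finset.card_pos.1 (by omega)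
    have hm := Finset.min'_mem A hne
    have := hφ (A.min' hne) (hUT (hA hm)) (A.erase (A.min' hne))
      ((Finset.erase_subset _ _).trans (hA.trans hUT))
      (by rw [Finset.card_erase_of_mem hm]; omega)
      (fun y hy => Finset.min'_lt_of_mem_erase_min' _ _ hy)
    rw [Finset.insert_erase hm] at this
    rw [this]
    exact (Finset.mem_filter.1 (hU (hA hm))).2

theorem exists_perm_sorted (x : Fin 3 → ℝ) (h01 : x 0 ≠ x 1) (h02 : x 0 ≠ x 2) (h12 : x 1 ≠ x 2) :
    ∃ σ : Equiv.Perm (Fin 3), x (σ 0) > x (σ 1) ∧ x (σ 1) > x (σ 2) := by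
  have hinj : Function.Injective x := by
    intro i j hij
    fin_cases i <;> fin_cases j <;> simp_all
  have hm := Tuple.monotone_sort x
  have hs : StrictMono (x ∘ Tuple.sort x) :=
    hm.strictMono_of_injective (hinj.comp (Tuple.sort x).injective)
  refine ⟨Fin.revPerm.trans (Tuple.sort x), ?_, ?_⟩
  · exact hs (show Fin.rev (1 : Fin 3) < Fin.rev 0 by decide)
  · exact hs (show Fin.rev (2 : Fin 3) < Fin.rev 1 by decide)

theorem sum_ne_of_indep {ι : Type} {v : ι → ℝ} (h : LinearIndependent ℚ v) {p q r s : ι}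
    (hr : p ≠ r) (hs : p ≠ s) : v p + v q ≠ v r + v s := by
  classical
  intro he
  have h1 : Finsupp.linearCombination ℚ v (Finsupp.single p 1 + Finsupp.single q 1) =
      Finsupp.linearCombination ℚ v (Finsupp.single r 1 + Finsupp.single s 1) := by
    simpa using he
  have h2 := DFunLike.congr_fun (h h1) p
  simp only [Finsupp.add_apply, Finsupp.single_apply, if_true, if_neg hr.symm, if_neg hs.symm] at h2
  split_ifs at h2 <;> norm_num at h2

theorem exists_color {N : ℕ} (d : Fin N → Fin N → ℝ)
    (h : LinearIndependent ℚ (fun p : {p : Fin N × Fin N // p.1 < p.2} => d p.1.1 p.1.2))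
    (a b c e : Fin N) (hab : a < b) (hbc : b < c) (hce : c < e) :
    ∃ σ : Equiv.Perm (Fin 3), Rvec d a b c e (σ 0) > Rvec d a b c e (σ 1) ∧
          Rvec d a b c e (σ 1) > Rvec d a b c e (σ 2) := by
  have hac := hab.trans hbc
  have hbe := hbc.trans hce
  have hae := hab.trans hbe
  apply exists_perm_sorted
  · exact sum_ne_of_indep h (p := ⟨(a, b), hab⟩) (q := ⟨(c, e), hce⟩) (r := ⟨(a, c), hac⟩)
      (s := ⟨(b, e), hbe⟩) (by simp [hbc.ne]) (by simp [hab.ne])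
  · exact sum_ne_of_indep h (p := ⟨(a, b), hab⟩) (q := ⟨(c, e), hce⟩) (r := ⟨(a, e), hae⟩)
      (s := ⟨(b, c), hbc⟩) (by simp [hbe.ne]) (by simp [hab.ne])
  · exact sum_ne_of_indep h (p := ⟨(a, c), hac⟩) (q := ⟨(b, e), hbe⟩) (r := ⟨(a, e), hae⟩)
      (s := ⟨(b, c), hbc⟩) (by simp [hce.ne]) (by simp [hab.ne])

/-- For every `k ≥ 1` there exists `N` such that every generic metric on `N` ordered
points (pairwise distances linearly independent over `ℚ`) contains `k` points, listed
by a strictly increasing map `g : Fin k → Fin N`, forming a monochromatic subspace: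
there is a permutation `σ` of `{1,2,3}` such that every quadruple `a < b < c < e` of
points in the image of `g` satisfies `R_{σ(1)} > R_{σ(2)} > R_{σ(3)}`. -/
theorem exists_monochromatic_subspace (k : ℕ) (hk : 1 ≤ k) :
    ∃ N : ℕ, ∀ d : Fin N → Fin N → ℝ, IsMetric d →
      LinearIndependent ℚ (fun p : {p : Fin N × Fin N // p.1 < p.2} => d p.1.1 p.1.2) →
      ∃ (g : Fin k → Fin N) (σ : Equiv.Perm (Fin 3)), StrictMono g ∧
        ∀ a b c e : Fin N,
          a ∈ Set.range g → b ∈ Set.range g → c ∈ Set.range g → e ∈ Set.range g →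
          a < b → b < c → c < e →
          Rvec d a b c e (σ 0) > Rvec d a b c e (σ 1) ∧
          Rvec d a b c e (σ 1) > Rvec d a b c e (σ 2) := by
  classical
  obtain ⟨N, hN⟩ := ramsey_aux (Equiv.Perm (Fin 3)) 4 k
  refine ⟨N, fun d _ hd => ?_⟩
  have hcol : ∀ A : Finset (Fin N), ∃ σ : Equiv.Perm (Fin 3), ∀ h : A.card = 4,
      let o := A.orderEmbOfFin h
      Rvec d (o 0) (o 1) (o 2) (o 3) (σ 0) > Rvec d (o 0) (o 1) (o 2) (o 3) (σ 1) ∧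
      Rvec d (o 0) (o 1) (o 2) (o 3) (σ 1) > Rvec d (o 0) (o 1) (o 2) (o 3) (σ 2) := by
    intro A
    by_cases h : A.card = 4
    · obtain ⟨σ, hσ⟩ := exists_color d hd (A.orderEmbOfFin h 0) (A.orderEmbOfFin h 1)
        (A.orderEmbOfFin h 2) (A.orderEmbOfFin h 3)
        ((A.orderEmbOfFin h).strictMono (by decide)) ((A.orderEmbOfFin h).strictMono (by decide))
        ((A.orderEmbOfFin h).strictMono (by decide))
      exact ⟨σ, fun _ => hσ⟩
    · exact ⟨1, fun h' => absurd h' h⟩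
  choose f hf using hcol
  obtain ⟨T, -, hT, σ, hσ⟩ := hN (Fin N) Finset.univ (by simp) f
  refine ⟨T.orderEmbOfFin hT, σ, (T.orderEmbOfFin hT).strictMono, ?_⟩
  intro a b c e ha hb hc he hab hbc hce
  rw [Finset.range_orderEmbOfFin] at ha hb hc he
  have hac := hab.trans hbc
  have hbe := hbc.trans hce
  have hae := hab.trans hbe
  have hcard : ({a, b, c, e} : Finset (Fin N)).card = 4 := by
    rw [Finset.card_insert_of_notMem, Finset.card_insert_of_notMem, Finset.card_insert_of_notMem,
      Finset.card_singleton]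
    · simp [hce.ne]
    · simp [hbc.ne, hbe.ne]
    · simp [hab.ne, hac.ne, hae.ne]
  have hmono : StrictMono ![a, b, c, e] := by
    rw [Fin.strictMono_iff_lt_succ]
    intro i
    fin_cases i
    · exact hab
    · exact hbc
    · exact hce
  have ho := Finset.orderEmbOfFin_unique hcard (f := ![a, b, c, e])
    (by intro i; fin_cases i <;> simp) hmono
  have hfA : f {a, b, c, e} = σ := by
    apply hσ _ _ hcard
    intro z hz
    simp only [Finset.mem_insert, Finset.mem_singleton] at hz
    rcases hz with rfl | rfl | rfl | rfl <;> assumption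
  have := hf {a, b, c, e} hcard
  dsimp only at this
  rw [hfA, ← ho] at this
  exact this
end
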